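/- The modal logic Grz.2 is characterized by the class of all finite lattices: a propositional modal formula is provable in Grz.2 if and only if it is valid in every Kripke frame that is a finite lattice (with accessibility relation ≤). -/

import Mathlib

namespace GrzPaper

/-- Propositional modal formulas, built from variables, falsum, implication and box. -/
inductive Formula : Type
  | var : ℕ → Formula
  | fls : Formula
  | impl : Formula → Formula → Formula
  | box : Formula → Formula
deriving DecidableEq

namespace Formula

def neg (φ : Formula) : Formula := impl φ fls
def tru : Formula := neg fls
def disj (φ ψ : Formula) : Formula := impl (neg φ) ψ
def conj (φ ψ : Formula) : Formula := neg (impl φ (neg ψ))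
def dia (φ : Formula) : Formula := neg (box (neg φ))

/-- Uniform substitution. -/
def subst (σ : ℕ → Formula) : Formula → Formula
  | var n => σ n
  | fls => fls
  | impl a b => impl (subst σ a) (subst σ b)
  | box a => box (subst σ a)

/-- Propositional (Boolean) evaluation, treating variables and boxed formulas as atoms. -/
def evalProp (v : Formula → Bool) : Formula → Bool
  | var n => v (var n)
  | fls => false
  | impl a b => !(evalProp v a) || evalProp v b
  | box a => v (box a)

/-- A propositional tautology: true under every Boolean valuation of the atoms
(variables and boxed subformulas). -/
def Tautology (φ : Formula) : Prop := ∀ v, evalProp v φ = true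

end Formula

open Formula

/-- A normal modal logic: contains all propositional tautologies and all instances of K,
closed under modus ponens, necessitation and uniform substitution. -/
structure IsNormalLogic (L : Set Formula) : Prop where
  taut : ∀ φ, Tautology φ → φ ∈ L
  axK : ∀ φ ψ, impl (box (impl φ ψ)) (impl (box φ) (box ψ)) ∈ L
  mp : ∀ φ ψ, impl φ ψ ∈ L → φ ∈ L → ψ ∈ L
  nec : ∀ φ, φ ∈ L → box φ ∈ L
  subst : ∀ φ σ, φ ∈ L → φ.subst σ ∈ L

/-- The normal modal logic generated by a set of axioms: the smallest normal modal
logic containing them. -/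
def Generated (Ax : Set Formula) : Set Formula :=
  ⋂₀ {L | IsNormalLogic L ∧ Ax ⊆ L}

def pv : Formula := var 0
def qv : Formula := var 1

def axT : Formula := impl (box pv) pv
def axFour : Formula := impl (box pv) (box (box pv))
def axGrz : Formula := impl (box (impl (box (impl pv (box pv))) pv)) pv
def axPoint2 : Formula := impl (dia (box pv)) (box (dia pv))
def axPoint3 : Formula := disj (box (impl (box pv) qv)) (box (impl (box qv) pv))

/-- penultimate(φ) : φ ∧ ◇¬φ ∧ □(¬φ → □¬φ). -/
def penultimate (φ : Formula) : Formula :=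
  conj φ (conj (dia (neg φ)) (box (impl (neg φ) (box (neg φ)))))

/-- contingent(φ) : ◇φ ∧ ◇¬φ. -/
def contingent (φ : Formula) : Formula := conj (dia φ) (dia (neg φ))

/-- The axiom Grz* : contingent(p) → ◇(penultimate(p) ∨ penultimate(¬p)). -/
def axGrzStar : Formula :=
  impl (contingent pv) (dia (disj (penultimate pv) (penultimate (neg pv))))

def Grz : Set Formula := Generated {axGrz}
def GrzStarLogic : Set Formula := Generated {axGrzStar}
def S4GrzStar : Set Formula := Generated {axT, axFour, axGrzStar}
def Grz2 : Set Formula := Generated {axGrz, axPoint2}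
def Grz3 : Set Formula := Generated {axGrz, axPoint3}
def KLogic : Set Formula := Generated ∅

/-- A Kripke model: an accessibility relation together with a valuation. -/
structure KripkeModel (W : Type) where
  rel : W → W → Prop
  val : ℕ → W → Prop

/-- Satisfaction of a modal formula at a world of a Kripke model. -/
def Satisfies {W : Type} (M : KripkeModel W) : W → Formula → Prop
  | w, .var n => M.val n w
  | _, .fls => False
  | w, .impl a b => Satisfies M w a → Satisfies M w b
  | w, .box a => ∀ v, M.rel w v → Satisfies M v a

/-- Validity of a formula on a Kripke frame. -/
def ValidOnFrame (W : Type) (R : W → W → Prop) (φ : Formula) : Prop :=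
  ∀ (val : ℕ → W → Prop) (w : W), Satisfies ⟨R, val⟩ w φ

/-- A model labeling of (M,w₀) for (N,u₀): a substitution σ such that every formula is
true at (M,w₀) iff its σ-instance is true at (N,u₀). -/
def ModelLabeling {W U : Type} (M : KripkeModel W) (w0 : W) (N : KripkeModel U) (u0 : U)
    (σ : ℕ → Formula) : Prop :=
  ∀ φ : Formula, Satisfies M w0 φ ↔ Satisfies N u0 (φ.subst σ)

/-- A frame labeling of the frame (W,R) with initial node w₀ for the pointed model (N,u₀). -/
def FrameLabeling {W U : Type} (R : W → W → Prop) (w0 : W) (N : KripkeModel U) (u0 : U)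
    (Φ : W → Formula) : Prop :=
  Satisfies N u0 (Φ w0) ∧
  (∀ u, N.rel u0 u → ∀ w, Satisfies N u (Φ w) →
    ∀ w', (Satisfies N u (dia (Φ w')) ↔ R w w')) ∧
  (∀ u, N.rel u0 u → ∃! w, Satisfies N u (Φ w))

def bigOr : List Formula → Formula
  | [] => fls
  | φ :: l => disj φ (bigOr l)

def bigAnd : List Formula → Formula
  | [] => tru
  | φ :: l => conj φ (bigAnd l)

open Classical in
/-- The disjunction ⋁ {Φ w : P w}. -/
noncomputable def labelFormula {W : Type} [Fintype W] (Φ : W → Formula) (P : W → Prop) :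
    Formula :=
  bigOr ((Finset.univ.filter P).toList.map Φ)

/-- Θ_A : the formula asserting that the button pattern is exactly A. -/
noncomputable def Theta {n : ℕ} (b : Fin n → Formula) (A : Finset (Fin n)) : Formula :=
  bigAnd ((Finset.univ : Finset (Fin n)).toList.map
    (fun i => if i ∈ A then box (b i) else neg (box (b i))))

/-- b₀,…,b_{n−1} are independent buttons at u₀: none is pushed (necessary) at u₀, and
necessarily, whenever the button pattern is exactly A, every larger pattern is possible. -/
def IndependentButtons {U : Type} (N : KripkeModel U) (u0 : U) {n : ℕ}
    (b : Fin n → Formula) : Prop :=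
  (∀ i, ¬ Satisfies N u0 (box (b i))) ∧
  ∀ A : Finset (Fin n), ∀ u, N.rel u0 u → Satisfies N u (Theta b A) →
    ∀ A' : Finset (Fin n), A ⊆ A' → Satisfies N u (dia (Theta b A'))

/-- r₀,…,r_{n−1} form a ratchet of length n at u₀. -/
def Ratchet {U : Type} (N : KripkeModel U) (u0 : U) {n : ℕ} (r : Fin n → Formula) : Prop :=
  (∀ i : Fin n, (i.val = 0 → Satisfies N u0 (box (r i))) ∧
      (0 < i.val → ¬ Satisfies N u0 (box (r i)))) ∧
  (∀ u, N.rel u0 u → ∀ i j : Fin n, i < j →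
      Satisfies N u (box (r j)) → Satisfies N u (box (r i))) ∧
  (∀ u, N.rel u0 u → ∀ i : Fin n, 0 < i.val →
      (∀ j : Fin n, Satisfies N u (box (r j)) ↔ j < i) →
        ∃ v, N.rel u v ∧ ∀ j : Fin n, Satisfies N v (box (r j)) ↔ j ≤ i)

/-- A (finite) tree order: a partial order with a least element in which the set of
predecessors of every element is linearly ordered. -/
def IsTreeOrder {W : Type} (R : W → W → Prop) : Prop :=
  IsPartialOrder W R ∧ (∃ r, ∀ x, R r x) ∧ ∀ x a b, R a x → R b x → R a b ∨ R b a

/-- A baled tree order: a partial order with a greatest element t whose removal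
leaves a tree. -/
def IsBaledTreeOrder {W : Type} (R : W → W → Prop) : Prop :=
  IsPartialOrder W R ∧ ∃ t : W, (∀ x, R x t) ∧
    (∃ r, r ≠ t ∧ ∀ x, x ≠ t → R r x) ∧
    (∀ x a b, x ≠ t → R a x → R b x → R a b ∨ R b a)

/-- Height of a node: the number of its strict predecessors. -/
noncomputable def heightOf {W : Type} (R : W → W → Prop) (x : W) : ℕ :=
  Nat.card {y : W // R y x ∧ y ≠ x}

/-- y is an immediate successor of x. -/
def ImmSucc {W : Type} (R : W → W → Prop) (x y : W) : Prop :=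
  R x y ∧ x ≠ y ∧ ∀ z, R x z → R z y → z = x ∨ z = y

def IsMaximal {W : Type} (R : W → W → Prop) (x : W) : Prop := ∀ z, R x z → z = x

/-- A regular finite tree: all maximal elements have the same height, and any two
elements of the same height have the same number of immediate successors. -/
def IsRegularTree {W : Type} (R : W → W → Prop) : Prop :=
  IsTreeOrder R ∧
  (∀ x y, IsMaximal R x → IsMaximal R y → heightOf R x = heightOf R y) ∧
  (∀ x y, heightOf R x = heightOf R y →
    Nat.card {z : W // ImmSucc R x z} = Nat.card {z : W // ImmSucc R y z})



/-! ### Soundness -/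

theorem satisfies_subst {W : Type} (M : KripkeModel W) (σ : ℕ → Formula) (φ : Formula) (w : W) :
    Satisfies M w (φ.subst σ) ↔
      Satisfies ⟨M.rel, fun n v => Satisfies M v (σ n)⟩ w φ := by
  induction φ generalizing w with
  | var n => rfl
  | fls => rfl
  | impl a b iha ihb => exact imp_congr (iha w) (ihb w)
  | box a ih => exact forall_congr' fun v => imp_congr Iff.rfl (ih v)

open Classical in
theorem Formula.Tautology.satisfies {W : Type} (M : KripkeModel W) (w : W) {φ : Formula}
    (h : Tautology φ) : Satisfies M w φ := by
  have key : ∀ ψ, evalProp (fun χ => decide (Satisfies M w χ)) ψ = true ↔ Satisfies M w ψ := by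
    intro ψ
    induction ψ with
    | var n => simp [evalProp]
    | fls => simp [evalProp, Satisfies]
    | impl a b iha ihb =>
      simp only [evalProp, Satisfies, ← iha, ← ihb]
      cases evalProp (fun χ => decide (Satisfies M w χ)) a <;> simp
    | box a => simp [evalProp]
  exact (key φ).1 (h _)

/-- The formulas valid on all frames of a class form a normal modal logic. -/
theorem isNormalLogic_validOnClass (C : ∀ W : Type, (W → W → Prop) → Prop) :
    IsNormalLogic {φ | ∀ W R, C W R → ValidOnFrame W R φ} where
  taut _ h _ _ _ _ w := h.satisfies _ w
  axK _ _ _ _ _ _ _ h h' v hv := h v hv (h' v hv)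
  mp _ _ h h' W R hC val w := h W R hC val w (h' W R hC val w)
  nec _ h W R hC val _ v _ := h W R hC val v
  subst φ σ h W R hC val w := (satisfies_subst ⟨R, val⟩ σ φ w).2 (h W R hC _ w)

theorem validOnFrame_axGrz {W : Type} [Finite W] [PartialOrder W] :
    ValidOnFrame W (· ≤ ·) axGrz := by
  intro val w hw
  have key : ∀ v, w ≤ v → val 0 v := by
    intro v
    induction v using WellFoundedGT.induction with
    | ind v ih =>
      intro hv
      refine hw v hv fun u hu hpu x hx => ?_
      by_contra hnx
      have h_eq : v = x := by
        by_contra hne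
        exact hnx (ih x (lt_of_le_of_ne (hu.trans hx) hne) (hv.trans (hu.trans hx)))
      subst h_eq
      exact hnx (le_antisymm hu hx ▸ hpu)
  exact key w le_rfl

theorem validOnFrame_axPoint2 {W : Type} [SemilatticeSup W] :
    ValidOnFrame W (· ≤ ·) axPoint2 := by
  intro val w hw v hv hnv
  exact hw fun u hu hbox => hnv (u ⊔ v) le_sup_right (hbox (u ⊔ v) le_sup_left)

/-! ### Maximal consistent theories -/

/-- A theory over `L`: a set of formulas containing `L` and closed under modus ponens. -/
structure IsTheory (L T : Set Formula) : Prop where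
  sub : L ⊆ T
  mp : ∀ {φ ψ}, impl φ ψ ∈ T → φ ∈ T → ψ ∈ T

/-- A maximal consistent theory over `L`. -/
structure IsMaxTheory (L T : Set Formula) : Prop extends IsTheory L T where
  fls_notMem : fls ∉ T
  mem_or_neg_mem : ∀ φ, φ ∈ T ∨ neg φ ∈ T

/-- The accessibility relation of the canonical model. -/
def CanonRel (u v : Set Formula) : Prop := ∀ φ, box φ ∈ u → φ ∈ v

section Canonical

variable {L : Set Formula}

theorem IsTheory.taut (hL : IsNormalLogic L) {T : Set Formula} (hT : IsTheory L T) {φ : Formula}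
    (h : ∀ v, evalProp v φ = true) : φ ∈ T :=
  hT.sub (hL.taut φ h)

theorem IsTheory.adjoin (hL : IsNormalLogic L) {T : Set Formula} (hT : IsTheory L T)
    (χ : Formula) : IsTheory L {θ | impl χ θ ∈ T} where
  sub θ hθ := hT.mp (hT.taut hL (φ := impl θ (impl χ θ)) fun v => by
    simp only [evalProp]; cases evalProp v θ <;> simp) (hT.sub hθ)
  mp {φ ψ} h h' := hT.mp (hT.mp (hT.taut hL
    (φ := impl (impl χ (impl φ ψ)) (impl (impl χ φ) (impl χ ψ))) fun v => by
      simp only [evalProp]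
      cases evalProp v φ <;> cases evalProp v ψ <;> cases evalProp v χ <;> rfl) h) h'

/-- Lindenbaum's lemma. -/
theorem IsTheory.exists_isMaxTheory (hL : IsNormalLogic L) {T : Set Formula} (hT : IsTheory L T)
    {ψ : Formula} (hψ : ψ ∉ T) : ∃ U, IsMaxTheory L U ∧ T ⊆ U ∧ ψ ∉ U := by
  obtain ⟨U, hTU, hU⟩ := zorn_subset_nonempty {U | IsTheory L U ∧ ψ ∉ U} (by
    intro c hc hchain ⟨A, hA⟩
    refine ⟨⋃₀ c, ⟨⟨fun φ hφ => ⟨A, hA, (hc hA).1.sub hφ⟩, ?_⟩, ?_⟩,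
      fun s hs => Set.subset_sUnion_of_mem hs⟩
    · rintro φ χ ⟨B, hB, hφχ⟩ ⟨C, hC, hφ⟩
      rcases hchain.total hB hC with h | h
      · exact ⟨C, hC, (hc hC).1.mp (h hφχ) hφ⟩
      · exact ⟨B, hB, (hc hB).1.mp hφχ (h hφ)⟩
    · rintro ⟨B, hB, h⟩
      exact (hc hB).2 h) T ⟨hT, hψ⟩
  have hUT : IsTheory L U := hU.prop.1
  have hψU : ψ ∉ U := hU.prop.2
  have himp : ∀ χ, χ ∉ U → impl χ ψ ∈ U := by
    intro χ hχ
    by_contra hn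
    refine hχ (hU.le_of_ge (y := {θ | impl χ θ ∈ U}) ⟨hUT.adjoin hL χ, hn⟩ (fun θ hθ => ?_) ?_)
    · exact hUT.mp (hUT.taut hL (φ := impl θ (impl χ θ)) fun v => by
        simp only [evalProp]; cases evalProp v θ <;> simp) hθ
    · exact hUT.taut hL (φ := impl χ χ) fun v => by simp [evalProp]
  refine ⟨U, ⟨hUT, fun h => hψU (hUT.mp (hUT.taut hL (φ := impl fls ψ) fun v => by
    simp [evalProp]) h), fun χ => ?_⟩, hTU, hψU⟩
  by_contra! hn
  exact hψU (hUT.mp (hUT.mp (hUT.taut hL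
    (φ := impl (impl χ ψ) (impl (impl (neg χ) ψ) ψ)) fun v => by
      simp only [evalProp, neg]
      cases evalProp v ψ <;> cases evalProp v χ <;> rfl) (himp χ hn.1)) (himp _ hn.2))

namespace IsMaxTheory

variable {u v w : Set Formula}

theorem mem_impl (hL : IsNormalLogic L) (hu : IsMaxTheory L u) {φ ψ : Formula} :
    impl φ ψ ∈ u ↔ (φ ∈ u → ψ ∈ u) := by
  refine ⟨fun h h' => hu.mp h h', fun h => ?_⟩
  rcases hu.mem_or_neg_mem φ with hφ | hφ
  · exact hu.mp (hu.taut hL (φ := impl ψ (impl φ ψ)) fun v => by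
      simp only [evalProp]; cases evalProp v ψ <;> simp) (h hφ)
  · exact hu.mp (hu.taut hL (φ := impl (neg φ) (impl φ ψ)) fun v => by
      simp only [evalProp, neg]; cases evalProp v φ <;> simp) hφ

theorem mem_neg (hL : IsNormalLogic L) (hu : IsMaxTheory L u) {φ : Formula} :
    neg φ ∈ u ↔ φ ∉ u := by
  simp only [neg, hu.mem_impl hL, hu.fls_notMem, imp_false]

theorem mem_conj (hL : IsNormalLogic L) (hu : IsMaxTheory L u) {φ ψ : Formula} :
    conj φ ψ ∈ u ↔ φ ∈ u ∧ ψ ∈ u := by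
  simp only [conj, hu.mem_impl hL, hu.mem_neg hL]
  tauto

theorem mem_box (hL : IsNormalLogic L) (hu : IsMaxTheory L u) {φ : Formula} :
    box φ ∈ u ↔ ∀ v, IsMaxTheory L v → CanonRel u v → φ ∈ v := by
  refine ⟨fun h v _ hv => hv φ h, fun h => ?_⟩
  by_contra hn
  have hT : IsTheory L {θ | box θ ∈ u} :=
    ⟨fun θ hθ => hu.sub (hL.nec θ hθ),
      fun {θ χ} h₁ h₂ => hu.mp (hu.mp (hu.sub (hL.axK θ χ)) h₁) h₂⟩
  obtain ⟨v, hv, huv, hφ⟩ := hT.exists_isMaxTheory hL hn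
  exact hφ (h v hv huv)

theorem mem_dia (hL : IsNormalLogic L) (hu : IsMaxTheory L u) {φ : Formula} :
    dia φ ∈ u ↔ ∃ v, IsMaxTheory L v ∧ CanonRel u v ∧ φ ∈ v := by
  rw [dia, hu.mem_neg hL, hu.mem_box hL]
  push Not
  refine exists_congr fun v => and_congr_right fun hv => and_congr_right fun _ => ?_
  rw [hv.mem_neg hL, not_not]

/-- Every instance of the Grzegorczyk axiom belongs to a maximal theory. -/
theorem of_box_grz (hL : IsNormalLogic L) (hG : axGrz ∈ L) (hu : IsMaxTheory L u) {φ : Formula}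
    (h : ∀ v, IsMaxTheory L v → CanonRel u v → box (impl φ (box φ)) ∈ v → φ ∈ v) : φ ∈ u := by
  refine hu.mp (hu.sub (hL.subst _ (fun _ => φ) hG)) ((hu.mem_box hL).2 fun v hv huv => ?_)
  exact (hv.mem_impl hL).2 (h v hv huv)

theorem canonRel_refl (hL : IsNormalLogic L) (hG : axGrz ∈ L) (hu : IsMaxTheory L u) :
    CanonRel u u :=
  fun φ hφ => hu.of_box_grz hL hG fun _ _ huv _ => huv φ hφ

theorem box_box_mem (hL : IsNormalLogic L) (hG : axGrz ∈ L) (hu : IsMaxTheory L u) {φ : Formula}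
    (hφ : box φ ∈ u) : box (box φ) ∈ u := by
  have key : conj φ (impl (box φ) (box (box φ))) ∈ u := by
    refine hu.of_box_grz hL hG fun v hv huv hq => ?_
    refine (hv.mem_conj hL).2 ⟨huv φ hφ, (hv.mem_impl hL).2 fun hφv => ?_⟩
    refine (hv.mem_box hL).2 fun y hy hvy => ?_
    by_contra hn
    have hqy : conj φ (impl (box φ) (box (box φ))) ∈ y :=
      (hy.mem_conj hL).2 ⟨hvy φ hφv, (hy.mem_impl hL).2 fun h => absurd h hn⟩
    exact hn ((hy.mem_box hL).2 fun z hz hyz =>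
      ((hz.mem_conj hL).1 (hyz _ (hy.mp (hvy _ hq) hqy))).1)
  exact hu.mp ((hu.mem_conj hL).1 key).2 hφ

theorem canonRel_trans (hL : IsNormalLogic L) (hG : axGrz ∈ L) (hu : IsMaxTheory L u)
    (huv : CanonRel u v) (hvw : CanonRel v w) : CanonRel u w :=
  fun _ hφ => hvw _ (huv _ (hu.box_box_mem hL hG hφ))

/-- Above every point there is a point from which on `φ`, once true, stays true, and which
moreover refutes `φ` if `box φ` fails at the given point. -/
theorem exists_settled (hL : IsNormalLogic L) (hG : axGrz ∈ L) (hu : IsMaxTheory L u)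
    (φ : Formula) : ∃ v, IsMaxTheory L v ∧ CanonRel u v ∧ box (impl φ (box φ)) ∈ v ∧
      (box φ ∉ u → φ ∉ v) := by
  by_cases hφ : box φ ∈ u
  · refine ⟨u, hu, hu.canonRel_refl hL hG, ?_, fun h => absurd hφ h⟩
    exact (hu.mem_box hL).2 fun v hv huv =>
      (hv.mem_impl hL).2 fun _ => huv _ (hu.box_box_mem hL hG hφ)
  · have h := hφ
    rw [hu.mem_box hL] at h
    push Not at h
    obtain ⟨v, hv, huv, hφv⟩ := h
    have h' := mt (hv.of_box_grz hL hG) hφv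
    push Not at h'
    obtain ⟨x, hx, hvx, hbox, hφx⟩ := h'
    exact ⟨x, hx, hu.canonRel_trans hL hG huv hvx, hbox, fun _ => hφx⟩

end IsMaxTheory

/-- The formulas possibly necessary at `w`; over `Grz.2` this is the greatest point above `w`. -/
def topTheory (L w : Set Formula) : Set Formula :=
  {φ | ∃ v, IsMaxTheory L v ∧ CanonRel w v ∧ box φ ∈ v}

namespace IsMaxTheory

variable {u w : Set Formula}

theorem isMaxTheory_topTheory (hL : IsNormalLogic L) (hG : axGrz ∈ L) (h2 : axPoint2 ∈ L)
    (hw : IsMaxTheory L w) : IsMaxTheory L (topTheory L w) where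
  sub φ hφ := ⟨w, hw, hw.canonRel_refl hL hG, hw.sub (hL.nec φ hφ)⟩
  mp := by
    rintro φ ψ ⟨v, hv, hwv, hφψ⟩ ⟨x, hx, hwx, hφ⟩
    have hdia : dia (box (box φ)) ∈ w :=
      (hw.mem_dia hL).2 ⟨x, hx, hwx, hx.box_box_mem hL hG hφ⟩
    have hbox : box (dia (box φ)) ∈ w := hw.mp (hw.sub (hL.subst _ (fun _ => box φ) h2)) hdia
    obtain ⟨y, hy, hvy, hφy⟩ := (hv.mem_dia hL).1 (hwv _ hbox)
    have hφψy : box (impl φ ψ) ∈ y := hvy _ (hv.box_box_mem hL hG hφψ)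
    exact ⟨y, hy, hw.canonRel_trans hL hG hwv hvy, hy.mp (hy.mp (hy.sub (hL.axK φ ψ)) hφψy) hφy⟩
  fls_notMem := by
    rintro ⟨v, hv, -, h⟩
    exact hv.fls_notMem (hv.canonRel_refl hL hG _ h)
  mem_or_neg_mem φ := by
    obtain ⟨v, hv, hwv, hφ, -⟩ := hw.exists_settled hL hG φ
    by_cases h : box (neg φ) ∈ v
    · exact Or.inr ⟨v, hv, hwv, h⟩
    · obtain ⟨x, hx, hvx, hφx⟩ := (hv.mem_dia hL).1 ((hv.mem_neg hL).2 h)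
      exact Or.inl ⟨x, hx, hw.canonRel_trans hL hG hwv hvx, hx.mp (hvx _ hφ) hφx⟩

theorem canonRel_topTheory (hu : IsMaxTheory L u) (hwu : CanonRel w u) :
    CanonRel u (topTheory L w) :=
  fun _ hφ => ⟨u, hu, hwu, hφ⟩

theorem box_mem_topTheory (hL : IsNormalLogic L) (hG : axGrz ∈ L) {φ : Formula}
    (h : φ ∈ topTheory L w) : box φ ∈ topTheory L w := by
  obtain ⟨v, hv, hwv, hφ⟩ := h
  exact ⟨v, hv, hwv, hv.box_box_mem hL hG hφ⟩

end IsMaxTheory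

end Canonical

/-! ### The lattice of repetition-free lists with a top element -/

/-- Lists over `α` without repetitions, ordered by the suffix relation. -/
structure NodupList (α : Type) where
  toList : List α
  nodup : toList.Nodup

namespace NodupList

variable {α : Type}

instance : PartialOrder (NodupList α) where
  le a b := a.toList <:+ b.toList
  le_refl a := List.suffix_refl a.toList
  le_trans _ _ _ h h' := List.IsSuffix.trans h h'
  le_antisymm := by
    rintro ⟨a, ha⟩ ⟨b, hb⟩ h h'
    have h_eq : a = b := List.IsSuffix.eq_of_length_le h h'.length_le
    subst h_eq
    rfl

instance [Finite α] : Finite (NodupList α) := by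
  classical
  have := Fintype.ofFinite α
  exact Finite.of_injective (β := {l : List α // l.Nodup}) (fun a => ⟨a.toList, a.nodup⟩) (by
    rintro ⟨a, ha⟩ ⟨b, hb⟩ h
    simpa using h)

theorem exists_isGLB_list (l l' : List α) :
    ∃ c, c <:+ l ∧ c <:+ l' ∧ ∀ d, d <:+ l → d <:+ l' → d <:+ c := by
  induction l with
  | nil => exact ⟨[], List.suffix_refl _, List.nil_suffix, fun d h _ => h⟩
  | cons a l ih =>
    by_cases h : a :: l <:+ l'
    · exact ⟨a :: l, List.suffix_refl _, h, fun d hd _ => hd⟩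
    · obtain ⟨c, hc, hc', hmax⟩ := ih
      refine ⟨c, hc.trans (List.suffix_cons a l), hc', fun d hd hd' => ?_⟩
      rcases List.suffix_cons_iff.1 hd with rfl | hd
      · exact absurd hd' h
      · exact hmax d hd hd'

theorem exists_isGLB (a b : NodupList α) : ∃ c, IsGLB {a, b} c := by
  obtain ⟨c, hca, hcb, hmax⟩ := exists_isGLB_list a.toList b.toList
  refine ⟨⟨c, a.nodup.sublist hca.sublist⟩, ?_, fun d hd => ?_⟩
  · rintro x (rfl | rfl)
    exacts [hca, hcb]
  · exact hmax d.toList (hd (by simp)) (hd (by simp))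

theorem le_total_of_le {a b c : NodupList α} (ha : a ≤ c) (hb : b ≤ c) : a ≤ b ∨ b ≤ a :=
  List.suffix_or_suffix_of_suffix ha hb

theorem exists_isGLB_withTop (a b : WithTop (NodupList α)) : ∃ c, IsGLB {a, b} c := by
  induction a with
  | top => exact ⟨b, by simp [isGLB_iff_le_iff]⟩
  | coe a =>
    induction b with
    | top => exact ⟨a, by simp [isGLB_iff_le_iff]⟩
    | coe b =>
      obtain ⟨c, hc⟩ := exists_isGLB a b
      refine ⟨c, isGLB_iff_le_iff.2 fun d => ?_⟩
      induction d with
      | top => simp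
      | coe d => simpa [mem_lowerBounds] using isGLB_iff_le_iff.1 hc d

theorem exists_isLUB_withTop (a b : WithTop (NodupList α)) : ∃ c, IsLUB {a, b} c := by
  by_cases hab : a ≤ b
  · exact ⟨b, ⟨by simp [hab], fun d hd => hd (by simp)⟩⟩
  by_cases hba : b ≤ a
  · exact ⟨a, ⟨by simp [hba], fun d hd => hd (by simp)⟩⟩
  refine ⟨⊤, by simp, fun d hd => ?_⟩
  have had : a ≤ d := hd (by simp)
  have hbd : b ≤ d := hd (by simp)
  induction d with
  | top => exact le_rfl
  | coe d =>
    lift a to NodupList α using ne_top_of_le_ne_top WithTop.coe_ne_top had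
    lift b to NodupList α using ne_top_of_le_ne_top WithTop.coe_ne_top hbd
    rw [WithTop.coe_le_coe] at hab hba had hbd
    exact absurd (le_total_of_le had hbd) (by tauto)

noncomputable instance : Lattice (WithTop (NodupList α)) :=
  { (inferInstance : PartialOrder (WithTop (NodupList α))) with
    inf := fun a b => (exists_isGLB_withTop a b).choose
    sup := fun a b => (exists_isLUB_withTop a b).choose
    inf_le_left := fun a b => (exists_isGLB_withTop a b).choose_spec.1 (by simp)
    inf_le_right := fun a b => (exists_isGLB_withTop a b).choose_spec.1 (by simp)
    le_inf := fun a b c hb hc => (exists_isGLB_withTop b c).choose_spec.2 (by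
      simp [hb, hc])
    le_sup_left := fun a b => (exists_isLUB_withTop a b).choose_spec.1 (by simp)
    le_sup_right := fun a b => (exists_isLUB_withTop a b).choose_spec.1 (by simp)
    sup_le := fun a b c ha hb => (exists_isLUB_withTop a b).choose_spec.2 (by
      simp [ha, hb]) }

end NodupList

/-! ### Completeness -/

/-- The formulas `ψ` such that `box ψ` is a subformula. -/
def boxArgs : Formula → Finset Formula
  | .var _ => ∅
  | .fls => ∅
  | .impl a b => boxArgs a ∪ boxArgs b
  | .box a => insert a (boxArgs a)

/-- Labels of the lists over `S`: adding `ψ` to a list moves up to a point settling `ψ`. -/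
theorem exists_labels {L : Set Formula} (hL : IsNormalLogic L) (hG : axGrz ∈ L)
    {w : Set Formula} (hw : IsMaxTheory L w) (S : Finset Formula) :
    ∃ f : List S → Set Formula, f [] = w ∧ (∀ l, IsMaxTheory L (f l)) ∧
      (∀ l l', l <:+ l' → CanonRel (f l) (f l')) ∧
      (∀ l, ∀ ψ ∈ l, box (impl ψ.1 (box ψ.1)) ∈ f l) ∧
      ∀ l ψ, box ψ.1 ∉ f l → ψ.1 ∉ f (ψ :: l) := by
  choose g hg hrel hset hneg using
    fun (u : {u // IsMaxTheory L u}) φ => u.2.exists_settled hL hG φ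
  let f : List S → {u // IsMaxTheory L u} :=
    fun l => l.foldr (fun ψ u => ⟨g u ψ.1, hg u ψ.1⟩) ⟨w, hw⟩
  have hcons : ∀ l ψ, CanonRel (f l).1 (f (ψ :: l)).1 := fun l ψ => hrel (f l) ψ.1
  refine ⟨fun l => (f l).1, rfl, fun l => (f l).2, fun l l' h => ?_, fun l => ?_,
    fun l ψ => hneg (f l) ψ.1⟩
  · induction l' with
    | nil =>
      rw [List.suffix_nil.1 h]
      exact (f []).2.canonRel_refl hL hG
    | cons a l' ih =>
      rcases List.suffix_cons_iff.1 h with rfl | h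
      · exact (f _).2.canonRel_refl hL hG
      · exact (f l).2.canonRel_trans hL hG (ih h) (hcons l' a)
  · induction l with
    | nil => simp
    | cons a l ih =>
      intro ψ hψ
      rcases List.mem_cons.1 hψ with rfl | hψ
      · exact hset (f l) ψ.1
      · exact hcons l a _ ((f l).2.box_box_mem hL hG (ih ψ hψ))

/-- A normal logic containing the axioms of `Grz.2` contains every formula valid on all
finite lattices. -/
theorem mem_of_valid_on_lattices {L : Set Formula} (hL : IsNormalLogic L) (hG : axGrz ∈ L)
    (h2 : axPoint2 ∈ L) {φ : Formula}
    (h : ∀ (W : Type) [Finite W] [Lattice W], ValidOnFrame W (· ≤ ·) φ) : φ ∈ L := by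
  by_contra hφ
  obtain ⟨w, hw, -, hφw⟩ :=
    (⟨subset_rfl, fun {a b} => hL.mp a b⟩ : IsTheory L L).exists_isMaxTheory hL hφ
  obtain ⟨f, hf0, hf, hmono, hset, hneg⟩ := exists_labels hL hG hw (boxArgs φ)
  have htop := hw.isMaxTheory_topTheory hL hG h2
  let lab : WithTop (NodupList (boxArgs φ)) → Set Formula :=
    fun x => WithTop.recTopCoe (topTheory L w) (fun a => f a.toList) x
  have hlab : ∀ x, IsMaxTheory L (lab x) := by
    intro x
    induction x with
    | top => exact htop
    | coe a => exact hf a.toList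
  have hrel : ∀ x y, x ≤ y → CanonRel (lab x) (lab y) := by
    intro x y hxy
    induction y with
    | top =>
      induction x with
      | top => exact htop.canonRel_refl hL hG
      | coe a =>
        exact (hf a.toList).canonRel_topTheory (hf0 ▸ hmono [] a.toList List.nil_suffix)
    | coe b =>
      lift x to NodupList (boxArgs φ) using ne_top_of_le_ne_top WithTop.coe_ne_top hxy
      exact hmono _ _ (WithTop.coe_le_coe.1 hxy)
  have truth : ∀ χ, boxArgs χ ⊆ boxArgs φ → ∀ x,
      Satisfies ⟨(· ≤ ·), fun n x => var n ∈ lab x⟩ x χ ↔ χ ∈ lab x := by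
    intro χ
    induction χ with
    | var n => exact fun _ x => Iff.rfl
    | fls => exact fun _ x => iff_of_false id (hlab x).fls_notMem
    | impl a b iha ihb =>
      intro hS x
      have hS' := Finset.union_subset_iff.1 hS
      exact (imp_congr (iha hS'.1 x) (ihb hS'.2 x)).trans ((hlab x).mem_impl hL).symm
    | box a ih =>
      intro hS x
      have hS' := Finset.insert_subset_iff.1 hS
      refine ⟨fun hx => ?_, fun hx y hxy => (ih hS'.2 y).2 (hrel x y hxy a hx)⟩
      have hx' : ∀ y, x ≤ y → a ∈ lab y := fun y hxy => (ih hS'.2 y).1 (hx y hxy)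
      induction x with
      | top => exact IsMaxTheory.box_mem_topTheory hL hG (hx' ⊤ le_rfl)
      | coe c =>
        by_contra hn
        by_cases hac : ⟨a, hS'.1⟩ ∈ c.toList
        · exact hn ((hf c.toList).mp ((hf c.toList).canonRel_refl hL hG _ (hset _ _ hac))
            (hx' c le_rfl))
        · exact hneg c.toList ⟨a, hS'.1⟩ hn
            (hx' (⟨_, List.nodup_cons.2 ⟨hac, c.nodup⟩⟩ : NodupList (boxArgs φ))
              (WithTop.coe_le_coe.2 (List.suffix_cons _ _)))
  refine hφw (hf0 ▸ (truth φ subset_rfl (⟨[], List.nodup_nil⟩ : NodupList (boxArgs φ))).1 ?_)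
  exact h (WithTop (NodupList (boxArgs φ))) _ _

/-- Grz.2 is characterized by the class of all finite lattices. -/
theorem statement6 (φ : Formula) :
    φ ∈ Grz2 ↔ ∀ (W : Type) [Finite W] [Lattice W], ValidOnFrame W (· ≤ ·) φ := by
  constructor
  · intro hφ W _ _
    refine hφ _ ⟨isNormalLogic_validOnClass fun V R =>
      ∃ (_ : Finite V) (_ : Lattice V), R = (· ≤ ·), ?_⟩ W _ ⟨‹_›, ‹_›, rfl⟩
    rintro ψ (rfl | rfl) V R ⟨_, _, rfl⟩
    · exact validOnFrame_axGrz
    · exact validOnFrame_axPoint2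
  · rintro h L ⟨hL, hAx⟩
    exact mem_of_valid_on_lattices hL (hAx (by simp)) (hAx (by simp)) h

end GrzPaper
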